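/- (Lower bound for the merit function on the safe region) Let ε ∈ (0, 3/4), μ ≥ 0, L' > 0, f* ∈ ℝ, and let f : ℝ^{n×p} → ℝ be differentiable. If X ∈ St(p,n)^ε satisfies f(X) ≥ f* and ‖∇f(X)‖_F ≤ L', then the merit function m(X) := f(X) − (1/2)⟨sym(Xᵀ∇f(X)), XᵀX − I_p⟩ + μN(X) satisfies m(X) ≥ f* − (ε√(1+ε)·L')/2. -/

import Mathlib

open Matrix Finset

noncomputable section

/-- Frobenius inner product `⟨A, B⟩ = Tr (Aᵀ * B)`. -/
def finner {n p : ℕ} (A B : Matrix (Fin n) (Fin p) ℝ) : ℝ :=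
  (Aᵀ * B).trace

/-- Frobenius norm `‖A‖_F = √(Tr (Aᵀ * A))`. -/
def fnorm {n p : ℕ} (A : Matrix (Fin n) (Fin p) ℝ) : ℝ :=
  Real.sqrt ((Aᵀ * A).trace)

/-- Skew-symmetric part `skew M = (M - Mᵀ)/2`. -/
def skewPart {m : ℕ} (M : Matrix (Fin m) (Fin m) ℝ) : Matrix (Fin m) (Fin m) ℝ :=
  (1 / 2 : ℝ) • (M - Mᵀ)

/-- Symmetric part `sym M = (M + Mᵀ)/2`. -/
def symPart {m : ℕ} (M : Matrix (Fin m) (Fin m) ℝ) : Matrix (Fin m) (Fin m) ℝ :=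
  (1 / 2 : ℝ) • (M + Mᵀ)

/-- Penalty function `N(X) = ‖XᵀX - I‖_F² / 4`. -/
def penaltyN {n p : ℕ} (X : Matrix (Fin n) (Fin p) ℝ) : ℝ :=
  (1 / 4 : ℝ) * fnorm (Xᵀ * X - 1) ^ 2

/-- Landing direction `Λ̃(X; g) = skew(g Xᵀ) X + λ X (XᵀX - I)` with gradient estimate `g`. -/
def landingDir {n p : ℕ} (lam : ℝ) (X g : Matrix (Fin n) (Fin p) ℝ) :
    Matrix (Fin n) (Fin p) ℝ :=
  skewPart (g * Xᵀ) * X + lam • (X * (Xᵀ * X - 1))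

attribute [local instance] Matrix.frobeniusNormedAddCommGroup Matrix.frobeniusNormedSpace

theorem finner_eq_sum {n p : ℕ} (A B : Matrix (Fin n) (Fin p) ℝ) :
    finner A B = ∑ x : Fin p × Fin n, A x.2 x.1 * B x.2 x.1 := by
  simp [finner, Matrix.trace, Matrix.mul_apply, Fintype.sum_prod_type]

theorem fnorm_eq_sqrt_finner {n p : ℕ} (A : Matrix (Fin n) (Fin p) ℝ) :
    fnorm A = Real.sqrt (finner A A) := rfl

theorem fnorm_nonneg {n p : ℕ} (A : Matrix (Fin n) (Fin p) ℝ) : 0 ≤ fnorm A :=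
  Real.sqrt_nonneg _

theorem fnorm_sq {n p : ℕ} (A : Matrix (Fin n) (Fin p) ℝ) : fnorm A ^ 2 = finner A A := by
  rw [fnorm_eq_sqrt_finner, Real.sq_sqrt]
  rw [finner_eq_sum]
  exact Finset.sum_nonneg fun _ _ => mul_self_nonneg _

/-- The Cauchy–Schwarz inequality for the Frobenius inner product. -/
theorem finner_le_fnorm_mul_fnorm {n p : ℕ} (A B : Matrix (Fin n) (Fin p) ℝ) :
    finner A B ≤ fnorm A * fnorm B := by
  rw [fnorm_eq_sqrt_finner, fnorm_eq_sqrt_finner]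
  simp only [finner_eq_sum, ← sq]
  exact Real.sum_mul_le_sqrt_mul_sqrt _ _ _

theorem fnorm_eq_norm {n p : ℕ} (A : Matrix (Fin n) (Fin p) ℝ) : fnorm A = ‖A‖ := by
  rw [Matrix.frobenius_norm_def, fnorm_eq_sqrt_finner, finner_eq_sum, Fintype.sum_prod_type,
    Finset.sum_comm, Real.sqrt_eq_rpow]
  simp [sq]

theorem fnorm_mul_le {l m n : ℕ} (A : Matrix (Fin l) (Fin m) ℝ) (B : Matrix (Fin m) (Fin n) ℝ) :
    fnorm (A * B) ≤ fnorm A * fnorm B := by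
  simpa only [fnorm_eq_norm] using Matrix.frobenius_norm_mul A B

theorem finner_symPart_of_transpose_eq {p : ℕ} (M D : Matrix (Fin p) (Fin p) ℝ) (hD : Dᵀ = D) :
    finner (symPart M) D = finner M D := by
  have h : (M * D).trace = (Mᵀ * D).trace := by
    rw [← Matrix.trace_transpose, Matrix.transpose_mul, hD, Matrix.trace_mul_comm]
  simp only [finner, symPart, Matrix.transpose_smul, Matrix.transpose_add,
    Matrix.transpose_transpose, Matrix.smul_mul, Matrix.add_mul, Matrix.trace_smul,
    Matrix.trace_add, smul_eq_mul, h]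
  ring

theorem finner_transpose_mul_left {n p q : ℕ} (X : Matrix (Fin n) (Fin p) ℝ)
    (G : Matrix (Fin n) (Fin q) ℝ) (D : Matrix (Fin p) (Fin q) ℝ) :
    finner (Xᵀ * G) D = finner G (X * D) := by
  simp [finner, Matrix.transpose_mul, Matrix.mul_assoc]

/-- Multiplying by `X` stretches a Frobenius norm by at most `√(1 + ‖XᵀX - I‖_F)`. -/
theorem fnorm_mul_sq_le {n p q : ℕ} (X : Matrix (Fin n) (Fin p) ℝ)
    (D : Matrix (Fin p) (Fin q) ℝ) :
    fnorm (X * D) ^ 2 ≤ (1 + fnorm (Xᵀ * X - 1)) * fnorm D ^ 2 := by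
  have h : fnorm (X * D) ^ 2 = fnorm D ^ 2 + finner D ((Xᵀ * X - 1) * D) := by
    simp only [fnorm_sq, finner, Matrix.sub_mul, Matrix.mul_sub, Matrix.trace_sub,
      Matrix.transpose_mul, Matrix.mul_assoc, Matrix.one_mul]
    ring
  have h₁ := finner_le_fnorm_mul_fnorm D ((Xᵀ * X - 1) * D)
  have h₂ := mul_le_mul_of_nonneg_left (fnorm_mul_le (Xᵀ * X - 1) D) (fnorm_nonneg D)
  linarith

theorem fnorm_mul_gram_sub_one_le {n p : ℕ} {ε : ℝ} (X : Matrix (Fin n) (Fin p) ℝ)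
    (hX : fnorm (Xᵀ * X - 1) ≤ ε) :
    fnorm (X * (Xᵀ * X - 1)) ≤ ε * Real.sqrt (1 + ε) := by
  have h₀ := fnorm_nonneg (Xᵀ * X - 1)
  have hε : 0 ≤ ε := h₀.trans hX
  refine (sq_le_sq₀ (fnorm_nonneg _) (by positivity)).1 ?_
  rw [mul_pow, Real.sq_sqrt (by positivity)]
  calc fnorm (X * (Xᵀ * X - 1)) ^ 2
      ≤ (1 + fnorm (Xᵀ * X - 1)) * fnorm (Xᵀ * X - 1) ^ 2 := fnorm_mul_sq_le X _
    _ ≤ (1 + ε) * ε ^ 2 := by gcongr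
    _ = ε ^ 2 * (1 + ε) := mul_comm _ _

/-- lower bound for the merit function on the safe region. -/
theorem merit_function_lower_bound {n p : ℕ} (ε μ L' fstar : ℝ)
    (hε : ε ∈ Set.Ioo (0 : ℝ) (3 / 4)) (hμ : 0 ≤ μ) (hL' : 0 < L')
    (f : Matrix (Fin n) (Fin p) ℝ → ℝ)
    (gradf : Matrix (Fin n) (Fin p) ℝ → Matrix (Fin n) (Fin p) ℝ)
    (hdiff : Differentiable ℝ f)
    (hgrad : ∀ Y H : Matrix (Fin n) (Fin p) ℝ, fderiv ℝ f Y H = finner (gradf Y) H)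
    (X : Matrix (Fin n) (Fin p) ℝ) (hX : fnorm (Xᵀ * X - 1) ≤ ε)
    (hflb : fstar ≤ f X) (hgb : fnorm (gradf X) ≤ L') :
    fstar - ε * Real.sqrt (1 + ε) * L' / 2 ≤
      f X - (1 / 2) * finner (symPart (Xᵀ * gradf X)) (Xᵀ * X - 1) + μ * penaltyN X := by
  have hcs : finner (symPart (Xᵀ * gradf X)) (Xᵀ * X - 1) ≤ L' * (ε * Real.sqrt (1 + ε)) := by
    rw [finner_symPart_of_transpose_eq _ _ (by simp), finner_transpose_mul_left]
    exact (finner_le_fnorm_mul_fnorm _ _).trans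
      (mul_le_mul hgb (fnorm_mul_gram_sub_one_le X hX) (fnorm_nonneg _) hL'.le)
  have hN : 0 ≤ μ * penaltyN X := mul_nonneg hμ (by unfold penaltyN; positivity)
  linarith
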